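/- The function (q,p) ↦ (f(q,p) + 1)² is integrable over ℝ²: ∬_{ℝ²} (f(q,p) + 1)² dq dp < ∞. -/

import Mathlib

open MeasureTheory Real

noncomputable section

/-- The sine integral `Si(x) = ∫₀ˣ (sin u)/u du`. -/
def Si (x : ℝ) : ℝ := ∫ u in (0:ℝ)..x, Real.sin u / u

/-- The function `f(q,p)`, the Weyl transform of `(A² − 3)/2`. -/
def ftrans (q p : ℝ) : ℝ :=
  (2 / π) * (Si ((4 / Real.sqrt 3) * q * ((-q + p * Real.sqrt 3) / 2))
    + Si ((4 / Real.sqrt 3) * q * ((-q - p * Real.sqrt 3) / 2))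
    + Si ((4 / Real.sqrt 3) * ((-q + p * Real.sqrt 3) / 2) * ((-q - p * Real.sqrt 3) / 2)))

lemma Si_eq_integral_sinc (x : ℝ) : Si x = ∫ u in (0:ℝ)..x, sinc u := by
  refine intervalIntegral.integral_congr_ae ?_
  filter_upwards [Measure.ae_ne volume (0 : ℝ)] with u hu _
  rw [sinc_of_ne_zero hu]

lemma continuous_Si : Continuous Si := by
  have h : Si = fun x => ∫ u in (0:ℝ)..x, sinc u := funext Si_eq_integral_sinc
  rw [h]
  exact intervalIntegral.continuous_primitive (fun a b => continuous_sinc.intervalIntegrable a b) 0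

lemma Si_neg (x : ℝ) : Si (-x) = -Si x := by
  have h := intervalIntegral.integral_comp_neg (a := 0) (b := x) sinc
  simp only [sinc_neg, neg_zero] at h
  rw [Si_eq_integral_sinc, Si_eq_integral_sinc, h, intervalIntegral.integral_symm]

lemma Si_sub_Si (x y : ℝ) : Si y - Si x = ∫ u in x..y, sinc u := by
  rw [Si_eq_integral_sinc, Si_eq_integral_sinc]
  exact intervalIntegral.integral_interval_sub_left
    (continuous_sinc.intervalIntegrable _ _) (continuous_sinc.intervalIntegrable _ _)

lemma abs_Si_sub_Si_le {x y : ℝ} (hx : 0 < x) (hxy : x ≤ y) :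
    |Si y - Si x| ≤ (y - x) / x := by
  rw [Si_sub_Si]
  have h := intervalIntegral.norm_integral_le_of_norm_le_const (a := x) (b := y) (C := 1 / x)
    (f := sinc) (fun u hu => by
      rw [Set.uIoc_of_le hxy] at hu
      have hu0 : 0 < u := hx.trans hu.1
      rw [sinc_of_ne_zero hu0.ne', Real.norm_eq_abs, abs_div, abs_of_pos hu0]
      exact div_le_div₀ zero_le_one (abs_sin_le_one u) hx hu.1.le)
  rw [Real.norm_eq_abs, abs_of_nonneg (sub_nonneg.2 hxy)] at h
  exact h.trans_eq (by ring)

lemma abs_Si_le_abs (x : ℝ) : |Si x| ≤ |x| := by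
  rw [Si_eq_integral_sinc]
  have h := intervalIntegral.norm_integral_le_of_norm_le_const (a := 0) (b := x) (C := 1)
    (f := sinc) (fun u _ => abs_sinc_le_one u)
  simpa using h

lemma integral_exp_neg_mul_mul_sin (t X : ℝ) :
    ∫ x in (0:ℝ)..X, exp (-x * t) * sin x
      = (1 + t ^ 2)⁻¹ - exp (-X * t) * (cos X + t * sin X) / (1 + t ^ 2) := by
  have ht : 1 + t ^ 2 ≠ 0 := by positivity
  have hd : ∀ x ∈ Set.uIcc 0 X, HasDerivAt
      (fun x => -(exp (-x * t) * (cos x + t * sin x) / (1 + t ^ 2))) (exp (-x * t) * sin x) x := by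
    intro x _
    have h1 : HasDerivAt (fun x : ℝ => exp (-x * t)) (exp (-x * t) * (-1 * t)) x :=
      (((hasDerivAt_id x).neg).mul_const t).exp
    have h2 : HasDerivAt (fun x : ℝ => cos x + t * sin x) (-sin x + t * cos x) x :=
      (hasDerivAt_cos x).add ((hasDerivAt_sin x).const_mul t)
    convert! ((h1.mul h2).div_const (1 + t ^ 2)).neg using 1
    field_simp
    ring
  rw [intervalIntegral.integral_eq_sub_of_hasDerivAt hd
    (Continuous.intervalIntegrable (by fun_prop) _ _)]
  simp
  ring

lemma integrable_exp_neg_mul_mul_sin (X : ℝ) :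
    Integrable (Function.uncurry fun x t : ℝ => exp (-x * t) * sin x)
      ((volume.restrict (Set.Ioc 0 X)).prod (volume.restrict (Set.Ioi 0))) := by
  have hc : Continuous (Function.uncurry fun x t : ℝ => exp (-x * t) * sin x) := by
    unfold Function.uncurry; fun_prop
  rw [integrable_prod_iff hc.aestronglyMeasurable]
  constructor
  · filter_upwards [ae_restrict_mem measurableSet_Ioc] with x hx
    exact (integrableOn_exp_mul_Ioi (neg_lt_zero.2 hx.1) 0).mul_const (sin x)
  · have h : IntegrableOn (fun x => |sinc x|) (Set.Ioc 0 X) :=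
      (continuous_sinc.abs.integrableOn_Icc).mono_set Set.Ioc_subset_Icc_self
    refine Integrable.congr h ?_
    filter_upwards [ae_restrict_mem measurableSet_Ioc] with x hx
    have h0 : 0 < x := hx.1
    simp only [Function.uncurry, norm_mul, Real.norm_eq_abs, abs_exp]
    rw [integral_mul_const, integral_exp_mul_Ioi (neg_lt_zero.2 h0), sinc_of_ne_zero h0.ne',
      abs_div, abs_of_pos h0]
    simp
    ring

lemma abs_Si_sub_pi_div_two_le {X : ℝ} (hX : 0 < X) : |Si X - π / 2| ≤ 1 / X := by
  have hSi : Si X = ∫ x in Set.Ioc 0 X, ∫ t in Set.Ioi (0:ℝ), exp (-x * t) * sin x := by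
    rw [Si, intervalIntegral.integral_of_le hX.le]
    refine setIntegral_congr_fun measurableSet_Ioc fun x hx => ?_
    have h0 : 0 < x := hx.1
    rw [integral_mul_const, integral_exp_mul_Ioi (neg_lt_zero.2 h0)]
    simp
    ring
  have hexp : IntegrableOn (fun t => exp (-X * t)) (Set.Ioi 0) :=
    integrableOn_exp_mul_Ioi (neg_lt_zero.2 hX) 0
  have hle : ∀ t : ℝ, ‖exp (-X * t) * (cos X + t * sin X) / (1 + t ^ 2)‖ ≤ exp (-X * t) := by
    intro t
    have h1 : |cos X + t * sin X| ≤ 1 + t ^ 2 := by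
      refine abs_le_of_sq_le_sq ?_ (by positivity)
      nlinarith [sin_sq_add_cos_sq X, sq_nonneg (t * cos X - sin X), sq_nonneg t, sq_nonneg (t ^ 2)]
    rw [norm_div, norm_mul, Real.norm_eq_abs, Real.norm_eq_abs, Real.norm_eq_abs, abs_exp,
      abs_of_pos (by positivity : 0 < 1 + t ^ 2), div_le_iff₀ (by positivity)]
    gcongr
  have hrem : IntegrableOn (fun t => exp (-X * t) * (cos X + t * sin X) / (1 + t ^ 2))
      (Set.Ioi 0) := by
    refine Integrable.mono' hexp (Continuous.aestronglyMeasurable ?_)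
      (Filter.Eventually.of_forall hle)
    exact Continuous.div (by fun_prop) (by fun_prop) fun t => by positivity
  have hval : Si X = π / 2
      - ∫ t in Set.Ioi (0:ℝ), exp (-X * t) * (cos X + t * sin X) / (1 + t ^ 2) := by
    rw [hSi, integral_integral_swap (integrable_exp_neg_mul_mul_sin X)]
    simp only [← intervalIntegral.integral_of_le hX.le, integral_exp_neg_mul_mul_sin]
    rw [integral_sub integrable_inv_one_add_sq.integrableOn hrem, integral_Ioi_inv_one_add_sq]
    simp
  have h := norm_integral_le_of_norm_le hexp (Filter.Eventually.of_forall hle)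
  rw [integral_exp_mul_Ioi (neg_lt_zero.2 hX)] at h
  rw [hval, sub_sub_cancel_left, abs_neg]
  simpa using h

lemma abs_Si_le (x : ℝ) : |Si x| ≤ 3 := by
  wlog hx : 0 ≤ x generalizing x
  · simpa [Si_neg] using this (-x) (by linarith)
  rcases le_total x 1 with h | h
  · exact (abs_Si_le_abs x).trans (by rw [abs_of_nonneg hx]; linarith)
  · have h1 := abs_Si_sub_pi_div_two_le (zero_lt_one.trans_le h)
    have h2 : 1 / x ≤ 1 := (div_le_one (by linarith)).2 h
    have := pi_lt_d2
    have := pi_pos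
    rw [abs_le] at h1 ⊢
    constructor <;> linarith

/-- The sum of `Si` over the three scaled pairwise products of `a`, `b`, `c`, plus `π / 2`. The
function `f + 1` is `2 / π` times this sum at suitable linear forms with `a + b + c = 0`. -/
def siSum (k a b c : ℝ) : ℝ := Si (k * a * b) + Si (k * a * c) + Si (k * b * c) + π / 2

lemma siSum_sq_le_of_le {k a b : ℝ} (hk : 2 ≤ k) (ha : 0 ≤ a) (hab : a ≤ b) :
    siSum k a b (-(a + b)) ^ 2 ≤ 484 * ((1 + a ^ 2)⁻¹ * (1 + b ^ 2)⁻¹) := by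
  rw [← mul_inv, ← div_eq_mul_inv, le_div_iff₀ (by positivity)]
  have hS : siSum k a b (-(a + b))
      = -(Si (k * a * (a + b)) - Si (k * a * b)) - (Si (k * b * (a + b)) - π / 2) := by
    simp only [siSum, mul_neg, Si_neg]
    ring
  rcases le_total b 1 with hb | hb
  · have h1 : |siSum k a b (-(a + b))| ≤ 11 := by
      rw [hS]
      have h1 := abs_le.1 (abs_Si_le (k * a * (a + b)))
      have h2 := abs_le.1 (abs_Si_le (k * a * b))
      have h3 := abs_le.1 (abs_Si_le (k * b * (a + b)))
      have := pi_lt_d2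
      have := pi_pos
      rw [abs_le]
      constructor <;> linarith
    have h2 : siSum k a b (-(a + b)) ^ 2 ≤ 121 := by
      have := sq_le_sq' (abs_le.1 h1).1 (abs_le.1 h1).2
      linarith
    have h3 : (1 + a ^ 2) * (1 + b ^ 2) ≤ 2 * 2 := by
      gcongr <;> nlinarith
    calc _ ≤ (121 : ℝ) * (2 * 2) := by gcongr
      _ = 484 := by norm_num
  · have hb0 : 0 < b := by linarith
    have hk0 : 0 < k := by linarith
    set u := Si (k * a * (a + b)) - Si (k * a * b) with hu
    set v := Si (k * b * (a + b)) - π / 2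
    have hvb : |b * v| ≤ 1 / 2 * b⁻¹ := by
      rw [abs_mul, abs_of_pos hb0]
      have h1 : |v| ≤ 1 / (k * b * (a + b)) := abs_Si_sub_pi_div_two_le (by positivity)
      have h2 : 1 / (k * b * (a + b)) ≤ 1 / (2 * b * b) := by
        gcongr; linarith
      calc b * |v| ≤ b * (1 / (2 * b * b)) := by gcongr; exact h1.trans h2
        _ = _ := by field_simp
    have hua : |b * u| ≤ a := by
      rcases ha.eq_or_lt with h0 | h0
      · simp [hu, ← h0]
      · rw [abs_mul, abs_of_pos hb0]
        have h1 := abs_Si_sub_Si_le (x := k * a * b) (y := k * a * (a + b)) (by positivity)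
          (by gcongr; linarith)
        calc b * |u| ≤ b * ((k * a * (a + b) - k * a * b) / (k * a * b)) := by gcongr
          _ = a := by field_simp; ring
    have hua' : a * |b * u| ≤ 1 := by
      rcases ha.eq_or_lt with h0 | h0
      · simp [← h0]
      · have h1 : |Si (k * a * (a + b)) - π / 2| ≤ 1 / (k * a * (a + b)) :=
          abs_Si_sub_pi_div_two_le (by positivity)
        have h2 : |Si (k * a * b) - π / 2| ≤ 1 / (k * a * b) :=
          abs_Si_sub_pi_div_two_le (by positivity)
        have h3 : 1 / (k * a * (a + b)) ≤ 1 / (2 * a * b) := by gcongr; linarith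
        have h4 : 1 / (k * a * b) ≤ 1 / (2 * a * b) := by gcongr
        have h5 : |u| ≤ 1 / (2 * a * b) + 1 / (2 * a * b) := by
          have : u = (Si (k * a * (a + b)) - π / 2) - (Si (k * a * b) - π / 2) := by
            rw [hu]; ring
          rw [this]
          exact (abs_sub _ _).trans (by linarith)
        rw [abs_mul, abs_of_pos hb0]
        calc a * (b * |u|) ≤ a * (b * (1 / (2 * a * b) + 1 / (2 * a * b))) := by gcongr
          _ = 1 := by field_simp; norm_num
    have hu2 : (b * u) ^ 2 * (1 + a ^ 2) ≤ 2 := by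
      have h1 : |b * u| ^ 2 ≤ 1 := by nlinarith [abs_nonneg (b * u)]
      have h2 : (a * |b * u|) ^ 2 ≤ 1 := pow_le_one₀ (by positivity) hua'
      rw [mul_pow, sq_abs] at h2
      rw [sq_abs] at h1
      linarith
    have hv2 : (b * v) ^ 2 * (1 + a ^ 2) ≤ 1 / 2 := by
      have h1 : (b * v) ^ 2 ≤ (1 / 2 * b⁻¹) ^ 2 :=
        sq_le_sq' (abs_le.1 hvb).1 (abs_le.1 hvb).2
      have h2 : 1 + a ^ 2 ≤ 2 * b ^ 2 := by nlinarith
      calc (b * v) ^ 2 * (1 + a ^ 2) ≤ (1 / 2 * b⁻¹) ^ 2 * (2 * b ^ 2) := by gcongr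
        _ = 1 / 2 := by field_simp
    have hsum : (-u - v) ^ 2 ≤ 2 * u ^ 2 + 2 * v ^ 2 := by nlinarith [sq_nonneg (u - v)]
    rw [hS]
    calc (-u - v) ^ 2 * ((1 + a ^ 2) * (1 + b ^ 2))
        ≤ (2 * u ^ 2 + 2 * v ^ 2) * ((1 + a ^ 2) * (b ^ 2 + b ^ 2)) := by
          gcongr
          nlinarith
      _ = 4 * ((b * u) ^ 2 * (1 + a ^ 2)) + 4 * ((b * v) ^ 2 * (1 + a ^ 2)) := by ring
      _ ≤ 484 := by linarith

lemma siSum_sq_le_of_nonneg {k a b : ℝ} (hk : 2 ≤ k) (ha : 0 ≤ a) (hb : 0 ≤ b) :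
    siSum k a b (-(a + b)) ^ 2 ≤ 484 * ((1 + a ^ 2)⁻¹ * (1 + b ^ 2)⁻¹) := by
  rcases le_total a b with h | h
  · exact siSum_sq_le_of_le hk ha h
  · have := siSum_sq_le_of_le hk hb h
    have e : siSum k a b (-(a + b)) = siSum k b a (-(b + a)) := by
      simp only [siSum, add_comm b a, mul_right_comm k b a]; ring
    rw [e, mul_comm (1 + a ^ 2)⁻¹]
    exact this

lemma siSum_sq_le_of_mul_nonneg {k a b : ℝ} (hk : 2 ≤ k) (hab : 0 ≤ a * b) :
    siSum k a b (-(a + b)) ^ 2 ≤ 484 * ((1 + a ^ 2)⁻¹ * (1 + b ^ 2)⁻¹) := by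
  rcases mul_nonneg_iff.1 hab with ⟨ha, hb⟩ | ⟨ha, hb⟩
  · exact siSum_sq_le_of_nonneg hk ha hb
  · have h := siSum_sq_le_of_nonneg hk (neg_nonneg.2 ha) (neg_nonneg.2 hb)
    have e : siSum k a b (-(a + b)) = siSum k (-a) (-b) (-(-a + -b)) := by
      simp only [siSum]; ring_nf
    rw [e]
    simpa only [neg_sq] using h

lemma siSum_sq_le {k a b c : ℝ} (hk : 2 ≤ k) (h : a + b + c = 0) :
    siSum k a b c ^ 2 ≤ 484 * ((1 + a ^ 2)⁻¹ * (1 + b ^ 2)⁻¹ + (1 + a ^ 2)⁻¹ * (1 + c ^ 2)⁻¹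
      + (1 + b ^ 2)⁻¹ * (1 + c ^ 2)⁻¹) := by
  have pab : 0 ≤ (1 + a ^ 2)⁻¹ * (1 + b ^ 2)⁻¹ := by positivity
  have pac : 0 ≤ (1 + a ^ 2)⁻¹ * (1 + c ^ 2)⁻¹ := by positivity
  have pbc : 0 ≤ (1 + b ^ 2)⁻¹ * (1 + c ^ 2)⁻¹ := by positivity
  by_cases hab : 0 ≤ a * b
  · have := siSum_sq_le_of_mul_nonneg hk hab
    rw [show -(a + b) = c by linarith] at this
    linarith
  by_cases hac : 0 ≤ a * c
  · have := siSum_sq_le_of_mul_nonneg hk hac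
    have e : siSum k a c (-(a + c)) = siSum k a b c := by
      rw [show -(a + c) = b by linarith]
      simp only [siSum, mul_right_comm k c b]; ring
    rw [e] at this
    linarith
  have hbc : 0 ≤ b * c := by
    by_contra hbc
    nlinarith [mul_pos (neg_pos.2 (not_le.1 hab)) (neg_pos.2 (not_le.1 hac)), sq_nonneg a]
  have := siSum_sq_le_of_mul_nonneg hk hbc
  have e : siSum k b c (-(b + c)) = siSum k a b c := by
    rw [show -(b + c) = a by linarith]
    simp only [siSum, mul_right_comm k c a, mul_right_comm k b a]; ring
  rw [e] at this
  linarith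

lemma MeasureTheory.Integrable.comp_linear_prod {h : ℝ × ℝ → ℝ} (hh : Integrable h volume)
    {α β γ δ : ℝ} (hdet : α * δ - β * γ ≠ 0) :
    Integrable (fun v : ℝ × ℝ => h (α * v.1 + β * v.2, γ * v.1 + δ * v.2)) volume := by
  let L : ℝ × ℝ →ₗ[ℝ] ℝ × ℝ :=
    { toFun := fun v => (α * v.1 + β * v.2, γ * v.1 + δ * v.2)
      map_add' := fun v w => by ext <;> simp <;> ring
      map_smul' := fun r v => by ext <;> simp <;> ring }
  have hL : LinearMap.det L ≠ 0 := by
    intro h0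
    refine (LinearMap.bot_lt_ker_of_det_eq_zero h0).ne' (LinearMap.ker_eq_bot'.2 fun v hv => ?_)
    have h1 : α * v.1 + β * v.2 = 0 := congrArg Prod.fst hv
    have h2 : γ * v.1 + δ * v.2 = 0 := congrArg Prod.snd hv
    refine Prod.ext (mul_left_cancel₀ hdet ?_) (mul_left_cancel₀ hdet ?_)
    · simp only [Prod.fst_zero]
      linear_combination δ * h1 - β * h2
    · simp only [Prod.snd_zero]
      linear_combination α * h2 - γ * h1
  have hmap : Integrable h (Measure.map L volume) := by
    rw [Measure.map_linearMap_addHaar_eq_smul_addHaar volume hL]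
    exact hh.smul_measure ENNReal.ofReal_ne_top
  exact hmap.comp_measurable L.continuous_of_finiteDimensional.measurable

lemma integrable_inv_one_add_sq_mul_linear {α β γ δ : ℝ} (hdet : α * δ - β * γ ≠ 0) :
    Integrable (fun v : ℝ × ℝ =>
      (1 + (α * v.1 + β * v.2) ^ 2)⁻¹ * (1 + (γ * v.1 + δ * v.2) ^ 2)⁻¹) volume :=
  (integrable_inv_one_add_sq.mul_prod integrable_inv_one_add_sq).comp_linear_prod hdet

lemma two_le_four_div_sqrt_three : 2 ≤ 4 / √3 := by
  rw [le_div_iff₀ (by positivity)]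
  have : √3 ≤ 2 := Real.sqrt_le_iff.2 (by norm_num)
  linarith

lemma ftrans_add_one_sq_le (q p : ℝ) :
    (ftrans q p + 1) ^ 2
      ≤ siSum (4 / √3) q ((-q + p * √3) / 2) ((-q - p * √3) / 2) ^ 2 := by
  have e : ftrans q p + 1
      = 2 / π * siSum (4 / √3) q ((-q + p * √3) / 2) ((-q - p * √3) / 2) := by
    have := pi_ne_zero
    rw [ftrans, siSum]
    field_simp
  have h : 2 / π ≤ 1 := (div_le_one pi_pos).2 (by linarith [pi_gt_three])
  rw [e, mul_pow]
  exact mul_le_of_le_one_left (sq_nonneg _) (pow_le_one₀ (by positivity) h)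

lemma continuous_ftrans : Continuous fun v : ℝ × ℝ => ftrans v.1 v.2 := by
  have h := continuous_Si
  unfold ftrans
  fun_prop

/-- `(q,p) ↦ (f(q,p) + 1)²` is integrable over `ℝ²`. -/
theorem integrable_ftrans_add_one_sq :
    Integrable (fun qp : ℝ × ℝ => (ftrans qp.1 qp.2 + 1) ^ 2) volume := by
  have hab := integrable_inv_one_add_sq_mul_linear (α := 1) (β := 0) (γ := -1 / 2) (δ := √3 / 2)
    (by simp)
  have hac := integrable_inv_one_add_sq_mul_linear (α := 1) (β := 0) (γ := -1 / 2) (δ := -√3 / 2)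
    (by simp)
  have hbc := integrable_inv_one_add_sq_mul_linear (α := -1 / 2) (β := √3 / 2) (γ := -1 / 2)
    (δ := -√3 / 2) (by ring_nf; simp)
  refine (((hab.add hac).add hbc).const_mul 484).mono'
    ((continuous_ftrans.add continuous_const).pow 2).aestronglyMeasurable
    (Filter.Eventually.of_forall fun v => ?_)
  rw [Real.norm_of_nonneg (sq_nonneg _)]
  refine (ftrans_add_one_sq_le v.1 v.2).trans
    ((siSum_sq_le two_le_four_div_sqrt_three (by ring)).trans_eq ?_)
  simp only [Pi.add_apply]
  ring_nf
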